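/- Let V be an n-vertex set with a partition V = V₁ ∪ ⋯ ∪ V_k, and let a random graph on V be drawn with independent edges: each pair of distinct vertices in the same cluster is joined with probability p and each pair in different clusters with probability q, where 0 < q ≤ p < 1 and p·n ≥ 1. Let V′ ⊆ V be a fixed subset (chosen independently of the edges). Then with probability 1 − O(n^{−7}), simultaneously for every cluster index i and every u ∈ V_i ∩ V′: q·|V′| + (p−q)·|V′ ∩ V_i| − 16·√p·√n·log n ≤ N_{V′}(u) ≤ q·|V′| + (p−q)·|V′ ∩ V_i| + 48·√p·√n·log n. -/

import Mathlib

open MeasureTheory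

noncomputable def bern (p : ℝ) : Measure Bool :=
  ENNReal.ofReal p • Measure.dirac true + ENNReal.ofReal (1 - p) • Measure.dirac false

noncomputable def sbm (n k : ℕ) (c : Fin n → Fin k) (p q : ℝ) :
    Measure ({e : Fin n × Fin n // e.1 < e.2} → Bool) :=
  Measure.pi fun e => bern (if c e.1.1 = c e.1.2 then p else q)

def clusterF {n k : ℕ} (c : Fin n → Fin k) (i : Fin k) : Finset (Fin n) :=
  Finset.univ.filter fun v => c v = i

/-- Adjacency of `u` and `v` in the graph `G` (no self-loops). -/
def adjB {n : ℕ} (G : {e : Fin n × Fin n // e.1 < e.2} → Bool) (u v : Fin n) : Bool :=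
  if h : u < v then G ⟨(u, v), h⟩ else if h' : v < u then G ⟨(v, u), h'⟩ else false

/-- `N_S(v)`: the number of neighbors of `v` in `S` (not counting `v` itself). -/
def nbr {n : ℕ} (G : {e : Fin n × Fin n // e.1 < e.2} → Bool) (S : Finset (Fin n)) (v : Fin n) :
    ℕ :=
  (S.filter fun u => adjB G u v = true).card

open ProbabilityTheory

lemma isProbabilityMeasure_bern {p : ℝ} (h0 : 0 ≤ p) (h1 : p ≤ 1) :
    IsProbabilityMeasure (bern p) := by
  constructor
  simp [bern, ← ENNReal.ofReal_add h0 (sub_nonneg.2 h1)]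

lemma integral_bern {p : ℝ} (h0 : 0 ≤ p) (h1 : p ≤ 1) (f : Bool → ℝ) :
    ∫ b, f b ∂(bern p) = p * f true + (1 - p) * f false := by
  have hi (a : ENNReal) (ha : a ≠ ⊤) (b : Bool) : Integrable f (a • Measure.dirac b) :=
    (Integrable.of_finite).smul_measure ha
  rw [bern, integral_add_measure (hi _ ENNReal.ofReal_ne_top _) (hi _ ENNReal.ofReal_ne_top _),
    integral_smul_measure, integral_smul_measure]
  simp [ENNReal.toReal_ofReal, h0, h1]

/-- The moment generating function of a centred Bernoulli variable is sub-Gaussian near zero. -/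
lemma integral_exp_bern_le {p l : ℝ} (h0 : 0 ≤ p) (h1 : p ≤ 1) (hl : |l| ≤ 1) :
    ∫ b, Real.exp (l * ((if b = true then 1 else 0) - p)) ∂(bern p) ≤ Real.exp (l ^ 2 * p) := by
  rw [integral_bern h0 h1]
  have hquad : Real.exp l - 1 - l ≤ l ^ 2 :=
    (le_abs_self _).trans (Real.abs_exp_sub_one_sub_id_le hl)
  have hsplit : Real.exp (l * (1 - p)) = Real.exp (-(l * p)) * Real.exp l := by
    rw [← Real.exp_add]; ring_nf
  calc
    _ = Real.exp (-(l * p)) * (p * (Real.exp l - 1) + 1) := by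
      simp only [reduceIte, Bool.false_eq_true, zero_sub, mul_neg, hsplit]
      ring
    _ ≤ Real.exp (-(l * p)) * Real.exp (p * (Real.exp l - 1)) := by
      gcongr
      exact Real.add_one_le_exp _
    _ = Real.exp (p * (Real.exp l - 1 - l)) := by
      rw [← Real.exp_add]; ring_nf
    _ ≤ _ := by
      rw [Real.exp_le_exp]
      nlinarith

/-- Chernoff bound for a sum of centred independent Bernoulli variables. -/
lemma pi_bern_sum_ge_le {ι : Type*} [Fintype ι] {r : ι → ℝ}
    (h0 : ∀ e, 0 ≤ r e) (h1 : ∀ e, r e ≤ 1) (S : Finset ι) {l : ℝ} (hl : |l| ≤ 1) (t : ℝ) :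
    Measure.pi (fun e => bern (r e))
        {G | t ≤ l * ∑ e ∈ S, ((if G e = true then (1 : ℝ) else 0) - r e)} ≤
      ENNReal.ofReal (Real.exp (l ^ 2 * ∑ e ∈ S, r e - t)) := by
  classical
  have hprob (e : ι) : IsProbabilityMeasure (bern (r e)) :=
    isProbabilityMeasure_bern (h0 e) (h1 e)
  let X : (ι → Bool) → ℝ := fun G => l * ∑ e ∈ S, ((if G e = true then (1 : ℝ) else 0) - r e)
  have hmgf : mgf X (Measure.pi fun e => bern (r e)) 1 ≤ Real.exp (l ^ 2 * ∑ e ∈ S, r e) := by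
    let f (e : ι) (b : Bool) : ℝ :=
      if e ∈ S then Real.exp (l * ((if b = true then 1 else 0) - r e)) else 1
    have hX : (fun G => Real.exp (1 * X G)) = fun G : ι → Bool => ∏ e, f e (G e) := by
      funext G
      simp only [X, f, one_mul, Finset.mul_sum, Real.exp_sum, Finset.prod_ite_mem,
        Finset.univ_inter]
    rw [mgf, hX, integral_fintype_prod_eq_prod, Finset.mul_sum, Real.exp_sum,
      ← Finset.univ_inter S, ← Finset.prod_ite_mem]
    refine Finset.prod_le_prod (fun e _ => integral_nonneg fun b => ?_) fun e _ => ?_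
    · simp only [f]
      split_ifs <;> positivity
    · by_cases he : e ∈ S
      · simpa only [f, he, if_true] using integral_exp_bern_le (h0 e) (h1 e) hl
      · simp [f, he]
  have hch := measure_ge_le_exp_mul_mgf (μ := Measure.pi fun e => bern (r e)) (X := X) t
    zero_le_one Integrable.of_finite
  rw [← ofReal_measureReal]
  refine ENNReal.ofReal_le_ofReal (hch.trans ?_)
  rw [sub_eq_neg_add, Real.exp_add, neg_one_mul]
  gcongr

/-- The pairs joining `u` to a vertex of `S`. -/
def incidentPairs {n : ℕ} (S : Finset (Fin n)) (u : Fin n) :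
    Finset {e : Fin n × Fin n // e.1 < e.2} :=
  Finset.univ.filter fun e => e.1.1 = u ∧ e.1.2 ∈ S ∨ e.1.2 = u ∧ e.1.1 ∈ S

lemma sum_incidentPairs {n : ℕ} (S : Finset (Fin n)) (u : Fin n)
    (f : {e : Fin n × Fin n // e.1 < e.2} → ℝ) (g : Fin n → ℝ)
    (hlt : ∀ v (h : v < u), f ⟨(v, u), h⟩ = g v) (hgt : ∀ v (h : u < v), f ⟨(u, v), h⟩ = g v) :
    ∑ e ∈ incidentPairs S u, f e = ∑ v ∈ S.erase u, g v := by
  refine Finset.sum_bij (fun e _ => if e.1.1 = u then e.1.2 else e.1.1) ?_ ?_ ?_ ?_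
  · rintro ⟨⟨a, b⟩, hab⟩ he
    simp only [incidentPairs, Finset.mem_filter, Finset.mem_univ, true_and] at he
    simp only [Finset.mem_erase]
    have := hab.ne
    grind
  · rintro ⟨⟨a, b⟩, hab⟩ he ⟨⟨a', b'⟩, hab'⟩ he' h
    simp only [incidentPairs, Finset.mem_filter, Finset.mem_univ, true_and] at he he' h
    simp only [Subtype.mk.injEq, Prod.mk.injEq]
    simp only at hab hab'
    grind
  · intro v hv
    obtain ⟨hne, hvS⟩ := Finset.mem_erase.1 hv
    rcases lt_or_gt_of_ne hne with h | h
    · exact ⟨⟨(v, u), h⟩, by simp [incidentPairs, hvS], by simp [hne]⟩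
    · exact ⟨⟨(u, v), h⟩, by simp [incidentPairs, hvS], by simp⟩
  · rintro ⟨⟨a, b⟩, hab⟩ he
    simp only [incidentPairs, Finset.mem_filter, Finset.mem_univ, true_and] at he
    by_cases ha : a = u
    · subst ha
      simpa using hgt b hab
    · obtain ⟨rfl, -⟩ := he.resolve_left fun h => ha h.1
      simpa [ha] using hlt a hab

lemma nbr_eq_sum_incidentPairs {n : ℕ} (G : {e : Fin n × Fin n // e.1 < e.2} → Bool)
    (S : Finset (Fin n)) (u : Fin n) :
    (nbr G S u : ℝ) = ∑ e ∈ incidentPairs S u, if G e = true then 1 else 0 := by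
  rw [sum_incidentPairs S u _ (fun v => if adjB G v u = true then 1 else 0)
    (fun v h => by simp [adjB, h]) (fun v h => by simp [adjB, h, h.not_gt]),
    Finset.sum_erase _ (by simp [adjB]), nbr, Finset.sum_boole]

lemma sum_edgeProb_incidentPairs {n k : ℕ} (c : Fin n → Fin k) (p q : ℝ) {S : Finset (Fin n)}
    {u : Fin n} (hu : u ∈ S) :
    ∑ e ∈ incidentPairs S u, (if c e.1.1 = c e.1.2 then p else q) =
      q * (S.card : ℝ) + (p - q) * ((S ∩ clusterF c (c u)).card : ℝ) - p := by
  rw [sum_incidentPairs S u _ (fun v => if c v = c u then p else q)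
    (fun v h => rfl) (fun v h => by simp [eq_comm]), Finset.sum_erase_eq_sub hu]
  have hinter : S ∩ clusterF c (c u) = S.filter fun v => c v = c u := by
    ext v; simp [clusterF]
  have hsum : ∀ v ∈ S, (if c v = c u then p else q) =
      q + (p - q) * (if c v = c u then 1 else 0) := by
    intro v _; split_ifs <;> ring
  rw [Finset.sum_congr rfl hsum, Finset.sum_add_distrib, ← Finset.mul_sum, Finset.sum_boole, hinter]
  simp [mul_comm]

/-- Deviation bound for the number of neighbors of a single vertex, in the direction given by the
sign of `l`. -/
lemma sbm_nbr_deviation_le {n k : ℕ} (c : Fin n → Fin k) {p q : ℝ} (hq : 0 < q) (hqp : q ≤ p)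
    (hp : p < 1) (hpn : 1 ≤ p * n) {S : Finset (Fin n)} {u : Fin n} (hu : u ∈ S) {l : ℝ}
    (hl : |l| = 1 / (Real.sqrt p * Real.sqrt n)) :
    sbm n k c p q {G | 16 * Real.log n - 1 ≤ l * ((nbr G S u : ℝ) -
        (q * (S.card : ℝ) + (p - q) * ((S ∩ clusterF c (c u)).card : ℝ) - p))} ≤
      ENNReal.ofReal (Real.exp 2 / (n : ℝ) ^ 16) := by
  have hp0 : 0 < p := hq.trans_le hqp
  have hn : (0 : ℝ) < n := by
    by_contra! h
    nlinarith
  have hs : 1 ≤ Real.sqrt p * Real.sqrt n := by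
    rw [← Real.sqrt_mul hp0.le]
    exact Real.one_le_sqrt.2 hpn
  have hl1 : |l| ≤ 1 := by
    rw [hl]
    exact div_le_one_of_le₀ hs (by positivity)
  have hsq : l ^ 2 * (p * n) = 1 := by
    rw [← sq_abs, hl, div_pow, mul_pow, Real.sq_sqrt hp0.le, Real.sq_sqrt hn.le]
    field_simp
  let r : {e : Fin n × Fin n // e.1 < e.2} → ℝ := fun e => if c e.1.1 = c e.1.2 then p else q
  have hr0 (e) : 0 ≤ r e := by simp only [r]; split_ifs <;> linarith
  have hr1 (e) : r e ≤ 1 := by simp only [r]; split_ifs <;> linarith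
  have hmean : ∑ e ∈ incidentPairs S u, r e ≤ p * n := by
    rw [sum_edgeProb_incidentPairs c p q hu]
    have h1 : ((S ∩ clusterF c (c u)).card : ℝ) ≤ S.card := by
      exact_mod_cast Finset.card_le_card Finset.inter_subset_left
    have h2 : (S.card : ℝ) ≤ n := by
      exact_mod_cast S.card_le_univ.trans_eq (Fintype.card_fin n)
    nlinarith [mul_le_mul_of_nonneg_left h1 (sub_nonneg.2 hqp)]
  have hch := pi_bern_sum_ge_le hr0 hr1 (incidentPairs S u) hl1 (16 * Real.log n - 1)
  have hset : {G | 16 * Real.log n - 1 ≤ l * ((nbr G S u : ℝ) -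
        (q * (S.card : ℝ) + (p - q) * ((S ∩ clusterF c (c u)).card : ℝ) - p))} =
      {G | 16 * Real.log n - 1 ≤
        l * ∑ e ∈ incidentPairs S u, ((if G e = true then (1 : ℝ) else 0) - r e)} := by
    ext G
    simp only [Set.mem_ofPred_eq, Finset.sum_sub_distrib, ← nbr_eq_sum_incidentPairs, r,
      sum_edgeProb_incidentPairs c p q hu]
  rw [hset]
  refine hch.trans (ENNReal.ofReal_le_ofReal ?_)
  calc
    _ ≤ Real.exp (2 - (16 : ℕ) * Real.log n) := by
      rw [Real.exp_le_exp]
      have := mul_le_mul_of_nonneg_left hmean (sq_nonneg l)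
      push_cast
      linarith
    _ = _ := by rw [Real.exp_sub, Real.exp_nat_mul, Real.exp_log hn]

/-- With probability `1 − O(n^{−7})`, simultaneously for every cluster index `i`
and every `u ∈ V_i ∩ V′`:
`q|V′| + (p−q)|V′ ∩ V_i| − 16√p·√n·log n ≤ N_{V′}(u) ≤ q|V′| + (p−q)|V′ ∩ V_i| + 48√p·√n·log n`. -/
theorem statement_3 :
    ∃ C : ℝ, 0 < C ∧
      ∀ (n k : ℕ) (c : Fin n → Fin k) (p q : ℝ),
        0 < q → q ≤ p → p < 1 → 1 ≤ p * n →
        ∀ V' : Finset (Fin n),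
          ENNReal.ofReal (1 - C / (n : ℝ) ^ 7) ≤
            sbm n k c p q
              {G | ∀ i : Fin k, ∀ u ∈ clusterF c i ∩ V',
                q * (V'.card : ℝ) + (p - q) * ((V' ∩ clusterF c i).card : ℝ) -
                    16 * Real.sqrt p * Real.sqrt n * Real.log n ≤ (nbr G V' u : ℝ) ∧
                (nbr G V' u : ℝ) ≤
                  q * (V'.card : ℝ) + (p - q) * ((V' ∩ clusterF c i).card : ℝ) +
                    48 * Real.sqrt p * Real.sqrt n * Real.log n} := by
  refine ⟨2 * Real.exp 2, by positivity, ?_⟩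
  intro n k c p q hq hqp hp hpn V'
  have hp0 : 0 < p := hq.trans_le hqp
  have hn : (1 : ℝ) ≤ n := by
    have : (0 : ℝ) ≤ n := n.cast_nonneg
    nlinarith
  have hs : 1 ≤ Real.sqrt p * Real.sqrt n := by
    rw [← Real.sqrt_mul hp0.le]
    exact Real.one_le_sqrt.2 hpn
  have hlog : 0 ≤ Real.log n := Real.log_nonneg hn
  have hprob : IsProbabilityMeasure (sbm n k c p q) := by
    have (e : {e : Fin n × Fin n // e.1 < e.2}) :
        IsProbabilityMeasure (bern (if c e.1.1 = c e.1.2 then p else q)) := by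
      split_ifs <;> exact isProbabilityMeasure_bern (by linarith) (by linarith)
    unfold sbm
    infer_instance
  set s := Real.sqrt p * Real.sqrt n with hsdef
  have hs0 : 0 < s := by linarith
  let dev (l : ℝ) (u : Fin n) : Set ({e : Fin n × Fin n // e.1 < e.2} → Bool) :=
    {G | 16 * Real.log n - 1 ≤ l * ((nbr G V' u : ℝ) -
      (q * (V'.card : ℝ) + (p - q) * ((V' ∩ clusterF c (c u)).card : ℝ) - p))}
  set good := {G | ∀ i : Fin k, ∀ u ∈ clusterF c i ∩ V',
                q * (V'.card : ℝ) + (p - q) * ((V' ∩ clusterF c i).card : ℝ) -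
                    16 * Real.sqrt p * Real.sqrt n * Real.log n ≤ (nbr G V' u : ℝ) ∧
                (nbr G V' u : ℝ) ≤
                  q * (V'.card : ℝ) + (p - q) * ((V' ∩ clusterF c i).card : ℝ) +
                    48 * Real.sqrt p * Real.sqrt n * Real.log n}
  have hcover : goodᶜ ⊆ ⋃ u ∈ V', (dev (1 / s) u ∪ dev (-(1 / s)) u) := by
    intro G hG
    contrapose! hG
    rw [Set.notMem_compl_iff]
    intro i u hu
    obtain ⟨hui, huV⟩ := Finset.mem_inter.1 hu
    obtain rfl : c u = i := by simpa [clusterF] using hui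
    simp only [Set.mem_iUnion, not_exists] at hG
    have hGu := hG u huV
    simp only [dev, Set.mem_union, Set.mem_ofPred_eq, not_or, not_le, neg_mul, one_div,
      inv_mul_eq_div] at hGu
    obtain ⟨h1, h2⟩ := hGu
    rw [div_lt_iff₀ hs0] at h1
    rw [← neg_div, div_lt_iff₀ hs0] at h2
    have hsl : 0 ≤ s * Real.log n := by positivity
    have e16 : 16 * Real.sqrt p * Real.sqrt n * Real.log n = 16 * (s * Real.log n) := by
      rw [hsdef]; ring
    have e48 : 48 * Real.sqrt p * Real.sqrt n * Real.log n = 48 * (s * Real.log n) := by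
      rw [hsdef]; ring
    rw [e16, e48]
    constructor <;> linarith
  have hbad : sbm n k c p q goodᶜ ≤ ENNReal.ofReal (2 * Real.exp 2 / (n : ℝ) ^ 7) := by
    set ε := Real.exp 2 / (n : ℝ) ^ 16 with hε
    have hε0 : 0 ≤ ε := by positivity
    have habs : |1 / s| = 1 / s := abs_of_pos (by positivity)
    calc
      _ ≤ ∑ u ∈ V', sbm n k c p q (dev (1 / s) u ∪ dev (-(1 / s)) u) :=
        (measure_mono hcover).trans (measure_biUnion_finset_le _ _)
      _ ≤ ∑ u ∈ V', ENNReal.ofReal (2 * ε) := by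
        refine Finset.sum_le_sum fun u hu => (measure_union_le _ _).trans ?_
        rw [two_mul, ENNReal.ofReal_add hε0 hε0]
        exact add_le_add (sbm_nbr_deviation_le c hq hqp hp hpn hu habs)
          (sbm_nbr_deviation_le c hq hqp hp hpn hu (by rw [abs_neg, habs]))
      _ = ENNReal.ofReal (V'.card * (2 * ε)) := by
        rw [Finset.sum_const, nsmul_eq_mul, ENNReal.ofReal_mul (Nat.cast_nonneg _),
          ENNReal.ofReal_natCast]
      _ ≤ _ := by
        refine ENNReal.ofReal_le_ofReal ?_
        have hcard : (V'.card : ℝ) ≤ n := by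
          exact_mod_cast V'.card_le_univ.trans_eq (Fintype.card_fin n)
        calc
          _ ≤ (n : ℝ) * (2 * ε) := by gcongr
          _ = 2 * Real.exp 2 / (n : ℝ) ^ 15 := by
            rw [hε]
            field_simp
          _ ≤ _ := by
            gcongr
            norm_num
  have hmeas : MeasurableSet good := Set.Finite.measurableSet (Set.toFinite _)
  rw [ENNReal.ofReal_sub _ (by positivity), ENNReal.ofReal_one, ← compl_compl good,
    prob_compl_eq_one_sub hmeas.compl]
  exact tsub_le_tsub_left hbad 1
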